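/- There exist constants C₀, C > 0 independent of ε and N such that: if ε ≤ C₀ N^{−1} and λ = 2ε ln N/√m < 1/4, then for all i = N/4, …, N/2 − 1 (so that x_{i−1}, x_i, x_{i+1} ∈ [x_{N/4−1}, 1/2]), | [ A(h_{i−1})(y(x_{i−1}) − y(x_i)) − A(h_i)(y(x_i) − y(x_{i+1})) ] / ( A(h_{i−1}) + A(h_i) ) | ≤ C N^{−2}, where y is the exact solution of the boundary value problem. -/

import Mathlib

/-- The modified Shishkin (Vulanović) mesh-generating function. -/
noncomputable def shishkinPsi (lam t : ℝ) : ℝ :=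
  if t ≤ 1 / 2 then
    (if t ≤ 1 / 4 then 4 * lam * t
     else 32 * (1 - 4 * lam) * (t - 1 / 4) ^ 3 + 4 * lam * t)
  else
    1 - (if 1 - t ≤ 1 / 4 then 4 * lam * (1 - t)
         else 32 * (1 - 4 * lam) * ((1 - t) - 1 / 4) ^ 3 + 4 * lam * (1 - t))

/-- `A(h) = (cosh(βh) − 1)/sinh(βh)`. -/
noncomputable def Acoef (β h : ℝ) : ℝ := (Real.cosh (β * h) - 1) / Real.sinh (β * h)

open Set Filter Topology

/-- A maximum principle: a function on `[0, 1]` that is nonpositive at the end points and strictly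
convex wherever it is positive is nonpositive. -/
lemma nonpos_of_second_deriv_pos {w w' w'' : ℝ → ℝ} (hc : ContinuousOn w (Icc 0 1))
    (hw : ∀ t ∈ Ioo (0:ℝ) 1, HasDerivAt w (w' t) t)
    (hw' : ∀ t ∈ Ioo (0:ℝ) 1, HasDerivAt w' (w'' t) t)
    (h0 : w 0 ≤ 0) (h1 : w 1 ≤ 0) (hpos : ∀ t ∈ Ioo (0:ℝ) 1, 0 < w t → 0 < w'' t) :
    ∀ t ∈ Icc (0:ℝ) 1, w t ≤ 0 := by
  by_contra! hcon
  obtain ⟨t, ht, hwt⟩ := hcon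
  obtain ⟨c, hcm, hmax⟩ := isCompact_Icc.exists_isMaxOn ⟨t, ht⟩ hc
  have hwc : 0 < w c := hwt.trans_le (hmax ht)
  have hc0 : c ≠ 0 := by rintro rfl; linarith
  have hc1 : c ≠ 1 := by rintro rfl; linarith
  have hcI : c ∈ Ioo (0:ℝ) 1 :=
    ⟨lt_of_le_of_ne hcm.1 hc0.symm, lt_of_le_of_ne hcm.2 hc1⟩
  have hlmax : IsLocalMax w c := hmax.isLocalMax (Icc_mem_nhds hcI.1 hcI.2)
  have hderiv : deriv w =ᶠ[𝓝 c] w' := by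
    filter_upwards [isOpen_Ioo.mem_nhds hcI] with s hs using (hw s hs).deriv
  have hdd : deriv (deriv w) c = w'' c := by
    rw [hderiv.deriv_eq, (hw' c hcI).deriv]
  have hlmin : IsLocalMin w c := isLocalMin_of_deriv_deriv_pos
    (by rw [hdd]; exact hpos c hcI hwc) hlmax.deriv_eq_zero (hw c hcI).continuousAt
  have hconst : w =ᶠ[𝓝 c] fun _ => w c := by
    filter_upwards [hlmax, hlmin] with s h₁ h₂ using le_antisymm h₁ h₂
  have hz : deriv (deriv w) c = 0 := by
    rw [hconst.deriv.deriv_eq]; simp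
  exact (hpos c hcI hwc).ne' (hdd ▸ hz)

lemma sinh_le_mul_cosh {z : ℝ} (hz : 0 ≤ z) : Real.sinh z ≤ z * Real.cosh z := by
  have hmono : MonotoneOn (fun t => t * Real.cosh t - Real.sinh t) (Ici 0) := by
    refine monotoneOn_of_deriv_nonneg (convex_Ici 0) (by fun_prop) (by fun_prop) fun t ht => ?_
    have hd : HasDerivAt (fun t => t * Real.cosh t - Real.sinh t) (t * Real.sinh t) t :=
      (((hasDerivAt_id' t).mul (Real.hasDerivAt_cosh t)).sub (Real.hasDerivAt_sinh t)).congr_deriv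
        (by ring)
    rw [hd.deriv]
    have ht' : 0 < t := by simpa using ht
    exact mul_nonneg ht'.le (Real.sinh_nonneg_iff.2 ht'.le)
  have := hmono (self_mem_Ici) (mem_Ici.2 hz) hz
  simp at this
  linarith

lemma mul_tanh_le_mul_tanh {a b : ℝ} (ha : 0 ≤ a) (hab : a ≤ b) :
    a * Real.tanh b ≤ b * Real.tanh a := by
  have hca := Real.cosh_pos a
  have hcb := Real.cosh_pos b
  have hsa : a ≤ Real.sinh a := Real.self_le_sinh_iff.2 ha
  have hd : Real.sinh (b - a) ≤ (b - a) * Real.cosh (b - a) := sinh_le_mul_cosh (by linarith)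
  have hcosh : Real.cosh (b - a) ≤ Real.cosh b := by
    rw [Real.cosh_le_cosh, abs_of_nonneg (by linarith), abs_of_nonneg (by linarith)]
    linarith
  have hcosha : 1 ≤ Real.cosh a := Real.one_le_cosh a
  have key : a * Real.sinh (b - a) ≤ (b - a) * (Real.sinh a * Real.cosh b) := by
    calc a * Real.sinh (b - a) ≤ a * ((b - a) * Real.cosh (b - a)) := by gcongr
      _ = (b - a) * (a * Real.cosh (b - a)) := by ring
      _ ≤ (b - a) * (Real.sinh a * Real.cosh b) := by
          have : 0 ≤ b - a := by linarith
          have := Real.cosh_pos (b - a)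
          gcongr
  rw [Real.sinh_sub] at key
  rw [Real.tanh_eq_sinh_div_cosh, Real.tanh_eq_sinh_div_cosh, ← mul_div_assoc, ← mul_div_assoc,
    div_le_div_iff₀ hcb hca]
  linarith

lemma Acoef_eq_tanh (β h : ℝ) : Acoef β h = Real.tanh (β * h / 2) := by
  rcases eq_or_ne (β * h) 0 with h0 | h0
  · simp [Acoef, h0]
  · obtain ⟨z, hz⟩ : ∃ z, β * h = 2 * z := ⟨β * h / 2, by ring⟩
    have hz0 : Real.sinh z ≠ 0 := by
      rw [Ne, Real.sinh_eq_zero]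
      rintro rfl
      simp [hz] at h0
    have hcz := (Real.cosh_pos z).ne'
    rw [Acoef, hz, Real.sinh_two_mul, Real.cosh_two_mul, Real.cosh_sq,
      mul_div_cancel_left₀ _ (two_ne_zero), Real.tanh_eq_sinh_div_cosh]
    field_simp
    ring

lemma Acoef_pos {β h : ℝ} (hβ : 0 < β) (hh : 0 < h) : 0 < Acoef β h := by
  rw [Acoef_eq_tanh, Real.tanh_eq_sinh_div_cosh]
  exact div_pos (Real.sinh_pos_iff.2 (by positivity)) (Real.cosh_pos _)

lemma Acoef_mono {β a b : ℝ} (hβ : 0 < β) (hab : a ≤ b) : Acoef β a ≤ Acoef β b := by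
  have h : 0 ≤ Real.sinh (β * b / 2 - β * a / 2) := by
    rw [Real.sinh_nonneg_iff]
    have := mul_le_mul_of_nonneg_left hab hβ.le
    linarith
  rw [Real.sinh_sub] at h
  rw [Acoef_eq_tanh, Acoef_eq_tanh, Real.tanh_eq_sinh_div_cosh, Real.tanh_eq_sinh_div_cosh,
    div_le_div_iff₀ (Real.cosh_pos _) (Real.cosh_pos _)]
  linarith

lemma mul_Acoef_le {β a b : ℝ} (hβ : 0 < β) (ha : 0 ≤ a) (hab : a ≤ b) :
    a * Acoef β b ≤ b * Acoef β a := by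
  have h := mul_tanh_le_mul_tanh (a := β * a / 2) (b := β * b / 2) (by positivity) (by gcongr)
  rw [Acoef_eq_tanh, Acoef_eq_tanh]
  refine le_of_mul_le_mul_left ?_ (half_pos hβ)
  calc _ = β * a / 2 * Real.tanh (β * b / 2) := by ring
    _ ≤ _ := h
    _ = _ := by ring

/-- The weighted difference of a function with bounded, Lipschitz derivative. -/
lemma abs_weighted_difference_le {r r' : ℝ → ℝ} {L K β x₀ x₁ x₂ c δ : ℝ} (hβ : 0 < β)
    (hr : ContinuousOn r (Icc 0 1)) (hr' : ∀ t ∈ Ioo (0:ℝ) 1, HasDerivAt r (r' t) t)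
    (hL : ∀ t ∈ Ioo (0:ℝ) 1, |r' t| ≤ L)
    (hK : ∀ s ∈ Ioo (0:ℝ) 1, ∀ t ∈ Ioo (0:ℝ) 1, |r' t - r' s| ≤ K * |t - s|)
    (hx₀ : 0 ≤ x₀) (h₀₁ : x₀ < x₁) (h₁₂ : x₁ < x₂) (hx₂ : x₂ ≤ 1) (hc : 0 ≤ c) (hδ : 0 ≤ δ)
    (hmono : x₁ - x₀ ≤ x₂ - x₁) (hratio : x₂ - x₁ ≤ c * (x₁ - x₀) + δ) :
    |(Acoef β (x₁ - x₀) * (r x₀ - r x₁) - Acoef β (x₂ - x₁) * (r x₁ - r x₂)) /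
      (Acoef β (x₁ - x₀) + Acoef β (x₂ - x₁))| ≤
      L * ((1 + c) * ((x₂ - x₁) - (x₁ - x₀)) + δ) + K * (x₂ - x₀) ^ 2 := by
  obtain ⟨ξ, hξ, hξe⟩ := exists_hasDerivAt_eq_slope r r' h₁₂
    (hr.mono (Icc_subset_Icc (by linarith) hx₂))
    (fun t ht => hr' t ⟨by linarith [ht.1], by linarith [ht.2]⟩)
  obtain ⟨η, hη, hηe⟩ := exists_hasDerivAt_eq_slope r r' h₀₁
    (hr.mono (Icc_subset_Icc hx₀ (by linarith)))
    (fun t ht => hr' t ⟨by linarith [ht.1], by linarith [ht.2]⟩)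
  have hξI : ξ ∈ Ioo (0:ℝ) 1 := ⟨by linarith [hξ.1], by linarith [hξ.2]⟩
  have hηI : η ∈ Ioo (0:ℝ) 1 := ⟨by linarith [hη.1], by linarith [hη.2]⟩
  have e₁ : r x₁ - r x₂ = -((x₂ - x₁) * r' ξ) := by
    rw [hξe]; field_simp [sub_ne_zero.2 h₁₂.ne']; ring
  have e₀ : r x₀ - r x₁ = -((x₁ - x₀) * r' η) := by
    rw [hηe]; field_simp [sub_ne_zero.2 h₀₁.ne']; ring
  have hLξ := hL ξ hξI
  have hKξ := hK η hηI ξ hξI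
  rw [abs_of_pos (by linarith [hξ.1, hη.2] : 0 < ξ - η)] at hKξ
  have hK0 : 0 ≤ K := by
    by_contra! hneg
    have := mul_neg_of_neg_of_pos hneg (by linarith [hξ.1, hη.2] : 0 < ξ - η)
    linarith [abs_nonneg (r' ξ - r' η)]
  have hKd : |r' ξ - r' η| ≤ K * (x₂ - x₀) :=
    hKξ.trans (by gcongr <;> linarith [hξ.2, hη.1])
  have hL0 : 0 ≤ L := (abs_nonneg _).trans hLξ
  have hAle := mul_Acoef_le hβ (by linarith : 0 ≤ x₁ - x₀) hmono
  have hAm := Acoef_mono hβ hmono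
  have hA₀ : 0 < Acoef β (x₁ - x₀) := Acoef_pos hβ (by linarith)
  rw [e₀, e₁]
  set A₀ := Acoef β (x₁ - x₀)
  set A₁ := Acoef β (x₂ - x₁)
  set h₀ := x₁ - x₀ with hh₀
  set h₁ := x₂ - x₁ with hh₁
  have hx : x₂ - x₀ = h₀ + h₁ := by ring
  rw [hx] at hKd ⊢
  have h₀pos : 0 < h₀ := by linarith
  have hA₁ : 0 < A₁ := by linarith
  rw [abs_div, abs_of_pos (by linarith : 0 < A₀ + A₁), div_le_iff₀ (by linarith)]
  have split : A₀ * -(h₀ * r' η) - A₁ * -(h₁ * r' ξ) =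
      A₀ * ((h₁ - h₀) * r' ξ) + A₀ * (h₀ * (r' ξ - r' η)) + ((A₁ - A₀) * h₁) * r' ξ := by ring
  have hgap : (A₁ - A₀) * h₁ ≤ c * ((h₁ - h₀) * A₀) + δ * A₁ := by
    calc (A₁ - A₀) * h₁ ≤ (A₁ - A₀) * (c * h₀ + δ) := by
          have : 0 ≤ A₁ - A₀ := by linarith
          gcongr
      _ = c * (h₀ * A₁ - h₀ * A₀) + δ * A₁ - δ * A₀ := by ring
      _ ≤ c * (h₁ * A₀ - h₀ * A₀) + δ * A₁ := by
          have := mul_nonneg hδ hA₀.le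
          have : c * (h₀ * A₁ - h₀ * A₀) ≤ c * (h₁ * A₀ - h₀ * A₀) := by gcongr
          linarith
      _ = _ := by ring
  have b₁ : |A₀ * ((h₁ - h₀) * r' ξ)| ≤ A₀ * ((h₁ - h₀) * L) := by
    rw [abs_mul, abs_mul, abs_of_pos hA₀, abs_of_nonneg (by linarith : 0 ≤ h₁ - h₀)]
    have : 0 ≤ h₁ - h₀ := by linarith
    gcongr
  have b₂ : |A₀ * (h₀ * (r' ξ - r' η))| ≤ A₀ * (K * (h₀ + h₁) ^ 2) := by
    rw [abs_mul, abs_mul, abs_of_pos hA₀, abs_of_pos h₀pos]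
    have : h₀ * |r' ξ - r' η| ≤ (h₀ + h₁) * (K * (h₀ + h₁)) := by
      gcongr
      linarith
    calc _ ≤ A₀ * ((h₀ + h₁) * (K * (h₀ + h₁))) := by gcongr
      _ = _ := by ring
  have b₃ : |((A₁ - A₀) * h₁) * r' ξ| ≤ (c * ((h₁ - h₀) * A₀) + δ * A₁) * L := by
    rw [abs_mul, abs_of_nonneg (mul_nonneg (by linarith) (by linarith))]
    gcongr
  rw [split]
  refine (abs_add_three _ _ _).trans ((add_le_add (add_le_add b₁ b₂) b₃).trans ?_)
  have p₁ : 0 ≤ A₁ * (L * ((1 + c) * (h₁ - h₀))) :=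
    mul_nonneg hA₁.le (mul_nonneg hL0 (mul_nonneg (by linarith) (by linarith)))
  have p₂ : 0 ≤ A₁ * (K * (h₀ + h₁) ^ 2) := by positivity
  have p₃ : 0 ≤ A₀ * (L * δ) := by positivity
  linarith [p₁, p₂, p₃]

/-- The weighted difference of a function bounded by `σ` at the three nodes. -/
lemma abs_weighted_difference_le_of_abs_le {A₀ A₁ s₀ s₁ s₂ σ : ℝ} (hA₀ : 0 < A₀) (hA₁ : 0 < A₁)
    (h₀ : |s₀| ≤ σ) (h₁ : |s₁| ≤ σ) (h₂ : |s₂| ≤ σ) :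
    |(A₀ * (s₀ - s₁) - A₁ * (s₁ - s₂)) / (A₀ + A₁)| ≤ 2 * σ := by
  rw [abs_div, abs_of_pos (by linarith : 0 < A₀ + A₁), div_le_iff₀ (by linarith)]
  rw [abs_le] at *
  have a₀ := mul_le_mul_of_nonneg_left (by linarith : s₀ - s₁ ≤ 2 * σ) hA₀.le
  have a₁ := mul_le_mul_of_nonneg_left (by linarith : s₁ - s₂ ≤ 2 * σ) hA₁.le
  have a₂ := mul_le_mul_of_nonneg_left (by linarith : -(2 * σ) ≤ s₀ - s₁) hA₀.le
  have a₃ := mul_le_mul_of_nonneg_left (by linarith : -(2 * σ) ≤ s₁ - s₂) hA₁.le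
  constructor <;> linarith

lemma exists_zero_of_le_deriv {g : ℝ → ℝ} {m : ℝ} (hm : 0 < m) (hg : ∀ u, m ≤ deriv g u) :
    ∃ u, g u = 0 ∧ |u| ≤ |g 0| / m := by
  have hd : Differentiable ℝ g := fun u =>
    differentiableAt_of_deriv_ne_zero (hm.trans_le (hg u)).ne'
  have hM : 0 ≤ |g 0| / m := by positivity
  have e : m * (|g 0| / m) = |g 0| := by field_simp
  have h₁ := mul_sub_le_image_sub_of_le_deriv hd hg hM
  have h₂ := mul_sub_le_image_sub_of_le_deriv hd hg (neg_nonpos.2 hM)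
  have hab := abs_le.1 (le_refl |g 0|)
  obtain ⟨u, hu, hu0⟩ := intermediate_value_Icc (by linarith : -(|g 0| / m) ≤ |g 0| / m)
    hd.continuous.continuousOn (show (0:ℝ) ∈ Icc (g (-(|g 0| / m))) (g (|g 0| / m)) from
      ⟨by linarith [hab.2], by linarith [hab.1]⟩)
  exact ⟨u, hu0, abs_le.2 hu⟩

lemma mul_abs_sub_le_of_le_deriv {g : ℝ → ℝ} {m : ℝ} (hm : 0 < m) (hg : ∀ u, m ≤ deriv g u)
    (u v : ℝ) : m * |u - v| ≤ |g u - g v| := by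
  have hd : Differentiable ℝ g := fun u =>
    differentiableAt_of_deriv_ne_zero (hm.trans_le (hg u)).ne'
  rcases le_total u v with h | h
  · have := mul_sub_le_image_sub_of_le_deriv hd hg h
    rw [abs_sub_comm, abs_sub_comm (g u), abs_of_nonneg (by linarith : 0 ≤ v - u)]
    exact this.trans (le_abs_self _)
  · have := mul_sub_le_image_sub_of_le_deriv hd hg h
    rw [abs_of_nonneg (by linarith : 0 ≤ u - v)]
    exact this.trans (le_abs_self _)

/-- The reduced problem `f(t, u(t)) = 0` has a solution on `[0, 1]` with bounded derivatives up to
order two. -/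
lemma exists_reduced_solution {m : ℝ} {f : ℝ → ℝ → ℝ} (hm : 0 < m)
    (hf : ContDiffOn ℝ 2 (Function.uncurry f) (Icc 0 1 ×ˢ univ))
    (hfy : ∀ a ∈ Icc (0:ℝ) 1, ∀ u : ℝ, m ≤ deriv (f a) u) :
    ∃ (u u' u'' : ℝ → ℝ) (K : ℝ), 0 < K ∧ (∀ t ∈ Icc (0:ℝ) 1, f t (u t) = 0) ∧
      ContinuousOn u (Icc 0 1) ∧ (∀ t ∈ Ioo (0:ℝ) 1, HasDerivAt u (u' t) t) ∧
      (∀ t ∈ Ioo (0:ℝ) 1, HasDerivAt u' (u'' t) t) ∧ (∀ t ∈ Icc (0:ℝ) 1, |u t| ≤ K) ∧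
      (∀ t ∈ Ioo (0:ℝ) 1, |u' t| ≤ K) ∧ (∀ t ∈ Ioo (0:ℝ) 1, |u'' t| ≤ K) := by
  set F := Function.uncurry f with hF
  set S : Set (ℝ × ℝ) := Icc 0 1 ×ˢ univ with hS
  have hSd : UniqueDiffOn ℝ S := (uniqueDiffOn_Icc zero_lt_one).prod uniqueDiffOn_univ
  set G := fderivWithin ℝ F S with hG
  have hGc : ContDiffOn ℝ 1 G S := hf.fderivWithin hSd (by norm_num)
  set H := fderivWithin ℝ G S with hH
  have hHc : ContinuousOn H S := hGc.continuousOn_fderivWithin hSd le_rfl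
  have hSn : ∀ t ∈ Ioo (0:ℝ) 1, ∀ v : ℝ, S ∈ 𝓝 (t, v) := fun t ht v =>
    prod_mem_nhds (Icc_mem_nhds ht.1 ht.2) univ_mem
  have hFd : ∀ t ∈ Ioo (0:ℝ) 1, ∀ v : ℝ, HasFDerivAt F (G (t, v)) (t, v) := fun t ht v =>
    (hf.differentiableOn (by norm_num) _
      (mem_of_mem_nhds (hSn t ht v))).hasFDerivWithinAt.hasFDerivAt (hSn t ht v)
  have hGd : ∀ t ∈ Ioo (0:ℝ) 1, ∀ v : ℝ, HasFDerivAt G (H (t, v)) (t, v) := fun t ht v =>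
    (hGc.differentiableOn (by norm_num) _
      (mem_of_mem_nhds (hSn t ht v))).hasFDerivWithinAt.hasFDerivAt (hSn t ht v)
  have hG01 : ∀ t ∈ Ioo (0:ℝ) 1, ∀ v : ℝ, m ≤ G (t, v) (0, 1) := by
    intro t ht v
    have h : HasDerivAt (f t) (G (t, v) (0, 1)) v :=
      (hFd t ht v).comp_hasDerivAt v ((hasDerivAt_const v t).prodMk (hasDerivAt_id' v))
    rw [← h.deriv]
    exact hfy t (Ioo_subset_Icc_self ht) v
  have hex : ∀ t, ∃ v, t ∈ Icc (0:ℝ) 1 → f t v = 0 ∧ |v| ≤ |f t 0| / m := by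
    intro t
    by_cases ht : t ∈ Icc (0:ℝ) 1
    · obtain ⟨v, hv⟩ := exists_zero_of_le_deriv hm (hfy t ht)
      exact ⟨v, fun _ => hv⟩
    · exact ⟨0, fun h => absurd h ht⟩
  choose u hu using hex
  have hsec : ∀ v : ℝ, ContinuousOn (fun t => f t v) (Icc 0 1) := fun v =>
    hf.continuousOn.comp (f := fun t : ℝ => (t, v)) (by fun_prop) fun t ht => ⟨ht, mem_univ _⟩
  have huc : ContinuousOn u (Icc 0 1) := by
    intro t ht
    have hlim : Tendsto (fun s => |f s (u t)| / m) (𝓝[Icc 0 1] t) (𝓝 0) := by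
      have := ((hsec (u t) t ht).abs.div_const m).tendsto
      simpa [(hu t ht).1] using this
    refine tendsto_iff_dist_tendsto_zero.2 (squeeze_zero' (Eventually.of_forall fun _ => dist_nonneg)
      ?_ hlim)
    filter_upwards [self_mem_nhdsWithin] with s hs
    have := mul_abs_sub_le_of_le_deriv hm (hfy s hs) (u s) (u t)
    rw [(hu s hs).1, zero_sub, abs_neg] at this
    rw [Real.dist_eq, le_div_iff₀ hm]
    linarith
  have hgraph : ContinuousOn (fun t => (t, u t)) (Icc (0:ℝ) 1) := continuousOn_id.prodMk huc
  have hgraphS : MapsTo (fun t => (t, u t)) (Icc (0:ℝ) 1) S := fun t ht => ⟨ht, mem_univ _⟩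
  obtain ⟨B₀, hB₀⟩ := isCompact_Icc.exists_bound_of_continuousOn huc
  have hGg : ContinuousOn (fun t => G (t, u t)) (Icc 0 1) :=
    hGc.continuousOn.comp hgraph hgraphS
  have hHg : ContinuousOn (fun t => H (t, u t)) (Icc 0 1) := hHc.comp hgraph hgraphS
  obtain ⟨B₁, hB₁⟩ := isCompact_Icc.exists_bound_of_continuousOn hGg
  obtain ⟨B₂, hB₂⟩ := isCompact_Icc.exists_bound_of_continuousOn
    (E := ℝ × ℝ →L[ℝ] ℝ × ℝ →L[ℝ] ℝ) hHg
  have hsmooth : ∀ t ∈ Ioo (0:ℝ) 1, ContDiffAt ℝ 2 u t := by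
    intro t ht
    have cdf : ContDiffAt ℝ 2 F (t, u t) := hf.contDiffAt (hSn t ht _)
    have hpos : 0 < G (t, u t) (0, 1) := hm.trans_le (hG01 t ht _)
    have hinv : (fderiv ℝ F (t, u t) ∘L .inr ℝ ℝ ℝ).IsInvertible := by
      rw [(hFd t ht (u t)).fderiv]
      refine ⟨ContinuousLinearEquiv.unitsEquivAut ℝ (Units.mk0 _ hpos.ne'), ?_⟩
      ext
      simp
    have h2 : (2 : WithTop ℕ∞) ≠ 0 := by norm_num
    refine (cdf.contDiffAt_implicitFunction h2 hinv).congr_of_eventuallyEq ?_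
    filter_upwards [cdf.eventually_apply_implicitFunction h2 hinv, isOpen_Ioo.mem_nhds ht]
      with s hs hsI
    have hsI' := Ioo_subset_Icc_self hsI
    have := mul_abs_sub_le_of_le_deriv hm (hfy s hsI') (u s) (cdf.implicitFunction h2 hinv s)
    have e₁ : f s (cdf.implicitFunction h2 hinv s) = 0 :=
      hs.trans (hu t (Ioo_subset_Icc_self ht)).1
    rw [(hu s hsI').1, e₁, sub_zero, abs_zero] at this
    have h0 : |u s - cdf.implicitFunction h2 hinv s| ≤ 0 := by
      by_contra! hp
      linarith [mul_pos hm hp]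
    exact sub_eq_zero.1 (abs_nonpos_iff.1 h0)
  have hu₁ : ∀ t ∈ Ioo (0:ℝ) 1, HasDerivAt u (deriv u t) t := fun t ht =>
    ((hsmooth t ht).differentiableAt (by norm_num)).hasDerivAt
  have hu₂ : ∀ t ∈ Ioo (0:ℝ) 1, HasDerivAt (deriv u) (deriv (deriv u) t) t := fun t ht =>
    (((hsmooth t ht).derivWithin (m := 1) (by norm_num)).differentiableAt (by norm_num)).hasDerivAt
  have hsplit : ∀ (T : ℝ × ℝ →L[ℝ] ℝ) (a b : ℝ), T (a, b) = T (a, 0) + b * T (0, 1) := by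
    intro T a b
    rw [← smul_eq_mul, ← map_smul, ← map_add]
    simp
  have hline : ∀ t ∈ Ioo (0:ℝ) 1, HasDerivAt (fun s => (s, u s)) (1, deriv u t) t := fun t ht =>
    (hasDerivAt_id' t).prodMk (hu₁ t ht)
  have hid₁ : ∀ t ∈ Ioo (0:ℝ) 1, G (t, u t) (1, deriv u t) = 0 := by
    intro t ht
    have h := (hFd t ht (u t)).comp_hasDerivAt (f := fun s => (s, u s)) t (hline t ht)
    refine h.unique ((hasDerivAt_const t (0:ℝ)).congr_of_eventuallyEq ?_)
    filter_upwards [isOpen_Ioo.mem_nhds ht] with s hs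
    exact (hu s (Ioo_subset_Icc_self hs)).1
  have hid₂ : ∀ t ∈ Ioo (0:ℝ) 1, H (t, u t) (1, deriv u t) (1, deriv u t) +
      G (t, u t) (0, deriv (deriv u) t) = 0 := by
    intro t ht
    have h := ((hGd t ht (u t)).comp_hasDerivAt (f := fun s => (s, u s)) t (hline t ht)).clm_apply
      ((hasDerivAt_const t (1:ℝ)).prodMk (hu₂ t ht))
    refine h.unique ((hasDerivAt_const t (0:ℝ)).congr_of_eventuallyEq ?_)
    filter_upwards [isOpen_Ioo.mem_nhds ht] with s hs using hid₁ s hs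
  have hb₁ : ∀ t ∈ Ioo (0:ℝ) 1, |deriv u t| ≤ B₁ / m := by
    intro t ht
    have e := hid₁ t ht
    rw [hsplit] at e
    have hn : |G (t, u t) (1, 0)| ≤ B₁ := by
      refine ((G (t, u t)).le_opNorm (1, 0)).trans ?_
      simpa using hB₁ t (Ioo_subset_Icc_self ht)
    rw [le_div_iff₀ hm]
    calc |deriv u t| * m ≤ |deriv u t| * |G (t, u t) (0, 1)| := by
          gcongr
          exact (hG01 t ht _).trans (le_abs_self _)
      _ = |G (t, u t) (1, 0)| := by
          rw [← abs_mul, eq_neg_of_add_eq_zero_right e, abs_neg]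
      _ ≤ B₁ := hn
  have hb₂ : ∀ t ∈ Ioo (0:ℝ) 1, |deriv (deriv u) t| ≤ B₂ * (1 + B₁ / m) ^ 2 / m := by
    intro t ht
    have e := hid₂ t ht
    rw [hsplit _ 0, ← Prod.zero_eq_mk, map_zero, zero_add] at e
    have hv : ‖((1:ℝ), deriv u t)‖ ≤ 1 + B₁ / m := by
      have h1 := hb₁ t ht
      rw [Prod.norm_def, norm_one, Real.norm_eq_abs]
      exact max_le (by linarith [abs_nonneg (deriv u t)]) (by linarith)
    have hv0 := (norm_nonneg _).trans hv
    have hn : |H (t, u t) (1, deriv u t) (1, deriv u t)| ≤ B₂ * (1 + B₁ / m) ^ 2 := by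
      refine ((H (t, u t)).le_opNorm₂ _ _).trans ?_
      have := hB₂ t (Ioo_subset_Icc_self ht)
      have hB₂0 := (norm_nonneg (H (t, u t))).trans this
      have := mul_nonneg hB₂0 hv0
      rw [pow_two, ← mul_assoc]
      gcongr
    rw [le_div_iff₀ hm]
    calc |deriv (deriv u) t| * m ≤ |deriv (deriv u) t| * |G (t, u t) (0, 1)| := by
          gcongr
          exact (hG01 t ht _).trans (le_abs_self _)
      _ = |H (t, u t) (1, deriv u t) (1, deriv u t)| := by
          rw [← abs_mul, eq_neg_of_add_eq_zero_right e, abs_neg]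
      _ ≤ _ := hn
  refine ⟨u, deriv u, deriv (deriv u),
    max 1 (max B₀ (max (B₁ / m) (B₂ * (1 + B₁ / m) ^ 2 / m))), by positivity,
    fun t ht => (hu t ht).1, huc, hu₁, hu₂, fun t ht => (hB₀ t ht).trans ?_,
    fun t ht => (hb₁ t ht).trans ?_, fun t ht => (hb₂ t ht).trans ?_⟩ <;> simp

/-- The exponential barrier for boundary layers of width `ε / √m` at both end points. -/
lemma le_layer_barrier {m ε K M : ℝ} {z z' z'' : ℝ → ℝ} (hm : 0 < m) (hε : 0 < ε) (hK : 0 ≤ K)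
    (hM : 0 ≤ M) (hc : ContinuousOn z (Icc 0 1))
    (hz : ∀ t ∈ Ioo (0:ℝ) 1, HasDerivAt z (z' t) t)
    (hz' : ∀ t ∈ Ioo (0:ℝ) 1, HasDerivAt z' (z'' t) t)
    (hode : ∀ t ∈ Ioo (0:ℝ) 1, 0 < z t → m * z t ≤ ε ^ 2 * z'' t + K * ε ^ 2)
    (h0 : z 0 ≤ M) (h1 : z 1 ≤ M) : ∀ t ∈ Icc (0:ℝ) 1,
      z t ≤ M * (Real.exp (-(√m / ε * t)) + Real.exp (-(√m / ε * (1 - t)))) + K * ε ^ 2 / m := by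
  set θ := √m / ε with hθ
  have hθ2 : ε ^ 2 * θ ^ 2 = m := by
    rw [hθ, div_pow, Real.sq_sqrt hm.le]
    field_simp
  have hE₁ : ∀ t, HasDerivAt (fun t => Real.exp (-(θ * t))) (-θ * Real.exp (-(θ * t))) t :=
    fun t => (((hasDerivAt_id' t).const_mul θ).neg.exp).congr_deriv
      (by simp only [Pi.neg_apply]; ring)
  have hE₂ : ∀ t, HasDerivAt (fun t => Real.exp (-(θ * (1 - t))))
      (θ * Real.exp (-(θ * (1 - t)))) t :=
    fun t => ((((hasDerivAt_id' t).const_sub 1).const_mul θ).neg.exp).congr_deriv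
      (by simp only [Pi.neg_apply]; ring)
  have hres : 0 ≤ K * ε ^ 2 / m := by positivity
  have key := nonpos_of_second_deriv_pos
    (w := fun t => z t - (M * (Real.exp (-(θ * t)) + Real.exp (-(θ * (1 - t)))) + K * ε ^ 2 / m))
    (w' := fun t => z' t - M * (-θ * Real.exp (-(θ * t)) + θ * Real.exp (-(θ * (1 - t)))))
    (w'' := fun t => z'' t - M * (-θ * (-θ * Real.exp (-(θ * t))) +
      θ * (θ * Real.exp (-(θ * (1 - t))))))
    (hc.sub (by fun_prop))
    (fun t ht => (hz t ht).sub ((((hE₁ t).add (hE₂ t)).const_mul M).add_const _))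
    (fun t ht => (hz' t ht).sub
      ((((hE₁ t).const_mul (-θ)).add ((hE₂ t).const_mul θ)).const_mul M)) ?_ ?_ ?_
  · intro t ht
    have := key t ht
    linarith
  · have := mul_nonneg hM (Real.exp_pos (-(θ * (1 - 0)))).le
    simp only [sub_zero, mul_one, mul_zero, neg_zero, Real.exp_zero] at this ⊢
    linarith
  · have := mul_nonneg hM (Real.exp_pos (-(θ * 1))).le
    simp only [sub_self, mul_one, mul_zero, neg_zero, Real.exp_zero] at this ⊢
    linarith
  · intro t ht hpos
    have hB : 0 ≤ M * (Real.exp (-(θ * t)) + Real.exp (-(θ * (1 - t)))) := by positivity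
    have hzt : 0 < z t := by linarith
    have ho := hode t ht hzt
    have hmz := mul_lt_mul_of_pos_left (sub_pos.1 hpos) hm
    have hcan : m * (K * ε ^ 2 / m) = K * ε ^ 2 := by field_simp
    rw [mul_add, hcan] at hmz
    have hεw : ε ^ 2 * (z'' t - M * (-θ * (-θ * Real.exp (-(θ * t))) +
        θ * (θ * Real.exp (-(θ * (1 - t)))))) =
        ε ^ 2 * z'' t - m * (M * (Real.exp (-(θ * t)) + Real.exp (-(θ * (1 - t))))) := by
      rw [← hθ2]; ring
    refine pos_of_mul_pos_right ?_ (sq_nonneg ε)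
    rw [hεw]
    linarith

/-- Outside the boundary layers, the solution is within `O(ε²)` of the reduced solution. -/
lemma abs_sub_reduced_le {m ε K : ℝ} {f : ℝ → ℝ → ℝ} {y u u' u'' : ℝ → ℝ} (hm : 0 < m)
    (hε : 0 < ε) (hfy : ∀ a ∈ Icc (0:ℝ) 1, ∀ v : ℝ, m ≤ deriv (f a) v)
    (hy : ContDiffOn ℝ 2 y (Icc 0 1)) (hy0 : y 0 = 0) (hy1 : y 1 = 0)
    (hode : ∀ a ∈ Ioo (0:ℝ) 1, ε ^ 2 * iteratedDerivWithin 2 y (Icc 0 1) a = f a (y a))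
    (hu : ∀ t ∈ Icc (0:ℝ) 1, f t (u t) = 0) (huc : ContinuousOn u (Icc 0 1))
    (hu' : ∀ t ∈ Ioo (0:ℝ) 1, HasDerivAt u (u' t) t)
    (hu'' : ∀ t ∈ Ioo (0:ℝ) 1, HasDerivAt u' (u'' t) t)
    (hK : ∀ t ∈ Icc (0:ℝ) 1, |u t| ≤ K) (hK'' : ∀ t ∈ Ioo (0:ℝ) 1, |u'' t| ≤ K) :
    ∀ t ∈ Icc (0:ℝ) 1, |y t - u t| ≤
      K * (Real.exp (-(√m / ε * t)) + Real.exp (-(√m / ε * (1 - t)))) + K * ε ^ 2 / m := by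
  have hI0 : (0:ℝ) ∈ Icc (0:ℝ) 1 := by simp
  have hI1 : (1:ℝ) ∈ Icc (0:ℝ) 1 := by simp
  have hK0 : 0 ≤ K := (abs_nonneg _).trans (hK 0 hI0)
  have hat : ∀ t ∈ Ioo (0:ℝ) 1, ContDiffAt ℝ 2 y t := fun t ht =>
    hy.contDiffAt (Icc_mem_nhds ht.1 ht.2)
  have hy' : ∀ t ∈ Ioo (0:ℝ) 1, HasDerivAt y (deriv y t) t := fun t ht =>
    ((hat t ht).differentiableAt (by norm_num)).hasDerivAt
  have hy'' : ∀ t ∈ Ioo (0:ℝ) 1,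
      HasDerivAt (deriv y) (iteratedDerivWithin 2 y (Icc 0 1) t) t := by
    intro t ht
    rw [iteratedDerivWithin_eq_iteratedDeriv (uniqueDiffOn_Icc zero_lt_one) (hat t ht)
      (Ioo_subset_Icc_self ht), iteratedDeriv_succ, iteratedDeriv_one]
    exact (((hat t ht).derivWithin (m := 1) (by norm_num)).differentiableAt
      (by norm_num)).hasDerivAt
  have hd : ∀ t ∈ Icc (0:ℝ) 1, Differentiable ℝ (f t) := fun t ht v =>
    differentiableAt_of_deriv_ne_zero (hm.trans_le (hfy t ht v)).ne'
  have hKb : ∀ t ∈ Ioo (0:ℝ) 1, |ε ^ 2 * u'' t| ≤ K * ε ^ 2 := by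
    intro t ht
    rw [abs_mul, abs_of_nonneg (sq_nonneg ε), mul_comm]
    gcongr
    exact hK'' t ht
  have hb0 := abs_le.1 (hK 0 hI0)
  have hb1 := abs_le.1 (hK 1 hI1)
  intro t ht
  have hup := le_layer_barrier (z := fun t => y t - u t) hm hε hK0 hK0 (hy.continuousOn.sub huc)
    (fun t ht => (hy' t ht).sub (hu' t ht)) (fun t ht => (hy'' t ht).sub (hu'' t ht))
    (fun t ht hpos => by
      have htI := Ioo_subset_Icc_self ht
      have h := mul_sub_le_image_sub_of_le_deriv (hd t htI) (hfy t htI) (sub_pos.1 hpos).le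
      rw [hu t htI, sub_zero, ← hode t ht] at h
      have := abs_le.1 (hKb t ht)
      linarith) (by linarith) (by linarith) t ht
  have hlo := le_layer_barrier (z := fun t => u t - y t) hm hε hK0 hK0 (huc.sub hy.continuousOn)
    (fun t ht => (hu' t ht).sub (hy' t ht)) (fun t ht => (hu'' t ht).sub (hy'' t ht))
    (fun t ht hpos => by
      have htI := Ioo_subset_Icc_self ht
      have h := mul_sub_le_image_sub_of_le_deriv (hd t htI) (hfy t htI) (sub_pos.1 hpos).le
      rw [hu t htI, zero_sub, ← hode t ht] at h
      have := abs_le.1 (hKb t ht)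
      linarith) (by linarith) (by linarith) t ht
  exact abs_le.2 ⟨by linarith, hup⟩

lemma exp_layer_le {m ε lam N t : ℝ} (hm : 0 < m) (hε : 0 < ε) (hN : 1 ≤ N)
    (hlam : lam = 2 * ε * Real.log N / √m) (ht : lam * (1 - 4 / N) ≤ t) :
    Real.exp (-(√m / ε * t)) ≤ Real.exp 8 / N ^ 2 := by
  have hN0 : 0 < N := by linarith
  have hs : 0 < √m := Real.sqrt_pos.2 hm
  have hmul : √m / ε * (lam * (1 - 4 / N)) ≤ √m / ε * t := by gcongr
  have he : √m / ε * (lam * (1 - 4 / N)) = 2 * Real.log N - 8 * (Real.log N / N) := by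
    rw [hlam]; field_simp; ring
  have hlog : Real.log N / N ≤ 1 := by
    rw [div_le_one hN0]
    exact Real.log_le_self hN0.le
  calc Real.exp (-(√m / ε * t)) ≤ Real.exp (8 - 2 * Real.log N) :=
        Real.exp_le_exp.2 (by linarith)
    _ = Real.exp 8 / N ^ 2 := by
        rw [Real.exp_sub, mul_comm, Real.exp_mul, Real.exp_log hN0, Real.rpow_two]

lemma shishkinPsi_of_le {lam q : ℝ} (hq : q ≤ 0) :
    shishkinPsi lam ((1 + q) / 4) = lam * (1 + q) := by
  rw [shishkinPsi, if_pos (by linarith), if_pos (by linarith)]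
  ring

lemma shishkinPsi_of_ge {lam q : ℝ} (hq : 0 ≤ q) (hq1 : q ≤ 1) :
    shishkinPsi lam ((1 + q) / 4) = (1 - 4 * lam) * q ^ 3 / 2 + lam * (1 + q) := by
  rcases hq.eq_or_lt with rfl | hq
  · rw [shishkinPsi_of_le le_rfl]; ring
  · rw [shishkinPsi, if_pos (by linarith), if_neg (by linarith)]
    ring

/-- The geometry of three consecutive nodes of the mesh with `4 / a` cells, outside the layer. -/
lemma shishkin_nodes {lam q a : ℝ} (hlam : 0 < lam) (hlam' : lam < 1 / 4) (ha : 0 < a)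
    (hq : q = 0 ∨ a ≤ q) (hqa : q + a ≤ 1) {x₀ x₁ x₂ : ℝ}
    (hx₀ : x₀ = shishkinPsi lam ((1 + (q - a)) / 4)) (hx₁ : x₁ = shishkinPsi lam ((1 + q) / 4))
    (hx₂ : x₂ = shishkinPsi lam ((1 + (q + a)) / 4)) :
    lam * (1 - a) ≤ x₀ ∧ x₀ < x₁ ∧ x₁ < x₂ ∧ x₂ ≤ 1 / 2 ∧ x₁ - x₀ ≤ x₂ - x₁ ∧
      (x₂ - x₁) - (x₁ - x₀) ≤ 3 * a ^ 2 ∧ x₂ - x₁ ≤ 7 * (x₁ - x₀) + a ^ 2 ∧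
      x₂ - x₀ ≤ 4 * a := by
  have hq0 : 0 ≤ q := by rcases hq with h | h <;> linarith
  have ha1 : a ≤ 1 := by linarith
  obtain ⟨κ, hκ⟩ : ∃ κ, κ = 1 - 4 * lam := ⟨_, rfl⟩
  have hκ0 : 0 < κ := by linarith
  have hκ1 : κ ≤ 1 := by linarith
  rw [shishkinPsi_of_ge hq0 (by linarith), ← hκ] at hx₁
  rw [shishkinPsi_of_ge (by linarith) hqa, ← hκ] at hx₂
  have hla : 0 < lam * a := mul_pos hlam ha
  have hla' : lam * a ≤ a / 4 := by nlinarith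
  have hh₁ : x₂ - x₁ = κ * (a * (3 * q ^ 2 + 3 * q * a + a ^ 2)) / 2 + lam * a := by
    rw [hx₁, hx₂]; ring
  have hx₂' : x₂ ≤ 1 / 2 := by
    have : (q + a) ^ 3 ≤ 1 := pow_le_one₀ (by linarith) hqa
    have := mul_le_mul_of_nonneg_left this hκ0.le
    have := mul_le_mul_of_nonneg_left hqa hlam.le
    linarith
  have hh₁le : x₂ - x₁ ≤ 2 * a := by
    have e : 3 * q ^ 2 + 3 * q * a + a ^ 2 ≤ 3 := by nlinarith
    have e' : κ * (a * (3 * q ^ 2 + 3 * q * a + a ^ 2)) ≤ 1 * (a * 3) := by gcongr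
    linarith
  have hh₁pos : 0 < κ * (a * (3 * q ^ 2 + 3 * q * a + a ^ 2)) := by positivity
  rcases hq with rfl | hq
  · rw [shishkinPsi_of_le (by linarith)] at hx₀
    have hh₀ : x₁ - x₀ = lam * a := by rw [hx₁, hx₀]; ring
    have hcube : κ * (a * (3 * 0 ^ 2 + 3 * 0 * a + a ^ 2)) ≤ 1 * (1 * (0 + 0 + a ^ 2)) := by
      gcongr <;> simp
    have := sq_nonneg a
    refine ⟨by rw [hx₀]; linarith, ?_, ?_, hx₂', ?_, ?_, ?_, ?_⟩ <;> linarith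
  · rw [shishkinPsi_of_ge (by linarith) (by linarith), ← hκ] at hx₀
    have hh₀ : x₁ - x₀ = κ * (a * (3 * q ^ 2 - 3 * q * a + a ^ 2)) / 2 + lam * a := by
      rw [hx₁, hx₀]; ring
    have hp₀ : 0 < κ * (a * (3 * q ^ 2 - 3 * q * a + a ^ 2)) := by
      have : 0 < 3 * q ^ 2 - 3 * q * a + a ^ 2 := by nlinarith
      positivity
    have hdiff : (x₂ - x₁) - (x₁ - x₀) = 3 * (κ * (a ^ 2 * q)) := by rw [hh₁, hh₀]; ring
    have hd0 : 0 ≤ κ * (a ^ 2 * q) := by positivity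
    have hd1 : κ * (a ^ 2 * q) ≤ 1 * (a ^ 2 * 1) := by
      gcongr
      linarith
    have hrat : κ * (a * (3 * q ^ 2 + 3 * q * a + a ^ 2)) ≤
        7 * (κ * (a * (3 * q ^ 2 - 3 * q * a + a ^ 2))) := by
      have : 0 ≤ κ * (a * (6 * ((3 * q - a) * (q - a)))) :=
        mul_nonneg hκ0.le (mul_nonneg ha.le (mul_nonneg (by norm_num)
          (mul_nonneg (by linarith) (by linarith))))
      linarith
    have hx₀' : 0 ≤ κ * (q - a) ^ 3 / 2 + lam * q := by
      have : 0 ≤ q - a := by linarith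
      positivity
    have := sq_nonneg a
    refine ⟨by rw [hx₀]; linarith, ?_, ?_, hx₂', ?_, ?_, ?_, ?_⟩ <;> linarith

/-- Lemma 2: on the part `[x_{N/4-1}, 1/2]` of the modified Shishkin mesh, assuming
`ε ≤ C₀/N` and `λ = 2ε ln N/√m < 1/4`, the weighted combination of differences of the
exact solution is bounded by `C/N²`. -/
theorem lemma2_difference_bound
    (m γ : ℝ) (k : ℕ) (f : ℝ → ℝ → ℝ)
    (hm : 0 < m) (hk : 2 ≤ k)
    (hf : ContDiffOn ℝ k (Function.uncurry f) (Set.Icc 0 1 ×ˢ Set.univ))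
    (hfy : ∀ a ∈ Set.Icc (0:ℝ) 1, ∀ u : ℝ, m ≤ deriv (f a) u)
    (hγ : ∀ a ∈ Set.Icc (0:ℝ) 1, ∀ u : ℝ, deriv (f a) u ≤ γ) :
    ∃ C₀ > (0:ℝ), ∃ C > (0:ℝ), ∀ (ε : ℝ) (N : ℕ) (y : ℝ → ℝ),
      0 < ε → ε < 1 → 0 < N → 4 ∣ N → ε ≤ C₀ / N →
      ContDiffOn ℝ 2 y (Set.Icc 0 1) → y 0 = 0 → y 1 = 0 →
      (∀ a ∈ Set.Ioo (0:ℝ) 1,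
        ε ^ 2 * iteratedDerivWithin 2 y (Set.Icc 0 1) a = f a (y a)) →
      2 * ε * Real.log N / Real.sqrt m < 1 / 4 →
      let lam : ℝ := 2 * ε * Real.log N / Real.sqrt m
      let β : ℝ := Real.sqrt γ / ε
      let x : ℕ → ℝ := fun i => shishkinPsi lam ((i : ℝ) / (N : ℝ))
      let h : ℕ → ℝ := fun i => x (i + 1) - x i
      ∀ i : ℕ, N / 4 ≤ i → i ≤ N / 2 - 1 →
        |(Acoef β (h (i - 1)) * (y (x (i - 1)) - y (x i)) -
          Acoef β (h i) * (y (x i) - y (x (i + 1)))) /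
         (Acoef β (h (i - 1)) + Acoef β (h i))| ≤ C / (N : ℝ) ^ 2 := by
  obtain ⟨u, u', u'', K, hK, hu, huc, hu', hu'', hKu, hKu', hKu''⟩ :=
    exists_reduced_solution hm (hf.of_le (by exact_mod_cast hk)) hfy
  have hγ0 : 0 < γ := hm.trans_le ((hfy 0 (by simp) 0).trans (hγ 0 (by simp) 0))
  have hLip : ∀ s ∈ Ioo (0:ℝ) 1, ∀ t ∈ Ioo (0:ℝ) 1, |u' t - u' s| ≤ K * |t - s| :=
    fun s hs t ht => (convex_Ioo 0 1).norm_image_sub_le_of_norm_hasDerivWithin_le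
      (fun x hx => (hu'' x hx).hasDerivWithinAt) hKu'' hs ht
  refine ⟨1, one_pos, 656 * K + 2 * (K * (Real.exp 8 + Real.exp 8) + K / m), by positivity, ?_⟩
  intro ε N y hε _ hN hN4 hεN hy hy0 hy1 hode hlam' lam β x h i hi hi'
  obtain ⟨n, rfl⟩ := hN4
  obtain ⟨j, rfl⟩ : ∃ j, i = n + j := ⟨i - n, by omega⟩
  have hn : 0 < n := by omega
  have hj : j + 1 ≤ n := by omega
  have hnR : (0:ℝ) < n := by exact_mod_cast hn
  have hn1 : (1:ℝ) ≤ n := by exact_mod_cast hn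
  have hβ : 0 < β := div_pos (Real.sqrt_pos.2 hγ0) hε
  have hlog : 0 < Real.log ((4 * n : ℕ) : ℝ) := Real.log_pos (by push_cast; linarith)
  have hlam : 0 < lam := div_pos (by positivity) (Real.sqrt_pos.2 hm)
  have hq : (j : ℝ) / n = 0 ∨ 1 / (n : ℝ) ≤ j / n := by
    rcases Nat.eq_zero_or_pos j with rfl | hj0
    · simp
    · right
      gcongr
      exact_mod_cast hj0
  have hqa : (j : ℝ) / n + 1 / n ≤ 1 := by
    rw [← add_div, div_le_one hnR]
    exact_mod_cast hj
  have hx₀ : x (n + j - 1) = shishkinPsi lam ((1 + ((j : ℝ) / n - 1 / n)) / 4) := by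
    simp only [x]
    congr 1
    rw [Nat.cast_sub (by omega)]
    push_cast
    field_simp
    ring
  have hx₁ : x (n + j) = shishkinPsi lam ((1 + (j : ℝ) / n) / 4) := by
    simp only [x]
    congr 1
    push_cast
    field_simp
  have hx₂ : x (n + j + 1) = shishkinPsi lam ((1 + ((j : ℝ) / n + 1 / n)) / 4) := by
    simp only [x]
    congr 1
    push_cast
    field_simp
    ring
  obtain ⟨g₀, g₀₁, g₁₂, g₂, gmono, gdiff, gratio, gwidth⟩ :=
    shishkin_nodes hlam hlam' (by positivity) hq hqa hx₀ hx₁ hx₂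
  have hh : h (n + j - 1) = x (n + j) - x (n + j - 1) := by
    simp only [h]
    rw [Nat.sub_add_cancel (by omega)]
  rw [hh]
  simp only [h]
  generalize x (n + j - 1) = x₀ at *
  generalize x (n + j) = x₁ at *
  generalize x (n + j + 1) = x₂ at *
  have ha1 : 1 / (n : ℝ) ≤ 1 := by rwa [div_le_one hnR]
  have hx₀0 : 0 ≤ x₀ := (mul_nonneg hlam.le (by linarith)).trans g₀
  have hNn : ((4 * n : ℕ) : ℝ) = 4 * n := by push_cast; ring
  have hεsq : K * ε ^ 2 / m ≤ K / m / ((4 * n : ℕ) : ℝ) ^ 2 := by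
    have : ε ^ 2 ≤ 1 / ((4 * n : ℕ) : ℝ) ^ 2 := by
      have := pow_le_pow_left₀ hε.le hεN 2
      rwa [div_pow, one_pow] at this
    calc K * ε ^ 2 / m ≤ K * (1 / ((4 * n : ℕ) : ℝ) ^ 2) / m := by gcongr
      _ = _ := by ring
  have hs : ∀ t, lam * (1 - 1 / n) ≤ t → 0 ≤ t → t ≤ 1 / 2 → |y t - u t| ≤
      (K * (Real.exp 8 + Real.exp 8) + K / m) / ((4 * n : ℕ) : ℝ) ^ 2 := by
    intro t ht ht0 ht1
    have hb := abs_sub_reduced_le hm hε hfy hy hy0 hy1 hode hu huc hu' hu'' hKu hKu'' t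
      ⟨ht0, by linarith⟩
    have hN1 : (1:ℝ) ≤ ((4 * n : ℕ) : ℝ) := by rw [hNn]; linarith
    have hfrac : 4 / ((4 * n : ℕ) : ℝ) = 1 / n := by rw [hNn]; field_simp
    have e₁ := exp_layer_le (t := t) hm hε hN1 (rfl : lam = _) (by rwa [hfrac])
    have e₂ := exp_layer_le (t := 1 - t) hm hε hN1 (rfl : lam = _) (by rw [hfrac]; linarith)
    refine hb.trans ?_
    calc _ ≤ K * (Real.exp 8 / ((4 * n : ℕ) : ℝ) ^ 2 + Real.exp 8 / ((4 * n : ℕ) : ℝ) ^ 2) +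
          K / m / ((4 * n : ℕ) : ℝ) ^ 2 := by gcongr
      _ = _ := by ring
  have hS := abs_weighted_difference_le_of_abs_le
    (Acoef_pos hβ (sub_pos.2 g₀₁)) (Acoef_pos hβ (sub_pos.2 g₁₂))
    (hs x₀ g₀ hx₀0 (by linarith)) (hs x₁ (by linarith) (by linarith) (by linarith))
    (hs x₂ (by linarith) (by linarith) g₂)
  have hR := abs_weighted_difference_le hβ huc hu' hKu' hLip hx₀0 g₀₁ g₁₂ (by linarith)
    (by norm_num : (0:ℝ) ≤ 7) (sq_nonneg (1 / (n : ℝ))) gmono gratio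
  have hR' : K * ((1 + 7) * ((x₂ - x₁) - (x₁ - x₀)) + (1 / (n : ℝ)) ^ 2) + K * (x₂ - x₀) ^ 2 ≤
      656 * K / ((4 * n : ℕ) : ℝ) ^ 2 := by
    have hw : 0 ≤ x₂ - x₀ := by linarith
    calc _ ≤ K * ((1 + 7) * (3 * (1 / (n : ℝ)) ^ 2) + (1 / (n : ℝ)) ^ 2) +
          K * (4 * (1 / (n : ℝ))) ^ 2 := by gcongr
      _ = _ := by rw [hNn]; field_simp; ring
  have hsum := (abs_add_le _ _).trans (add_le_add (hR.trans hR') hS)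
  rw [← add_div] at hsum
  rw [add_div (656 * K), mul_div_assoc 2]
  refine le_of_eq_of_le ?_ hsum
  congr 2
  ring
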